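/- Let F and φ be twice continuously differentiable convex functions on ℝ^d with F μ_F-strongly convex, and suppose ‖∇²F(x) − ∇²F₁(x)‖₂ ≤ σ for all x, where φ(x) = F₁(x) + (σ/2)‖x‖₂². Then F is 1-relatively smooth and μ_F/(μ_F + 2σ)-relatively strongly convex with respect to φ; that is, (μ_F/(μ_F+2σ)) D_φ[x](y) ≤ D_F[x](y) ≤ D_φ[x](y) for all x, y ∈ ℝ^d. -/

import Mathlib

open RealInnerProductSpace

/-- Bregman divergence `D_f[x](y) = f(y) − f(x) − ⟪∇f(x), y − x⟫` given a gradient map `gf`. -/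
noncomputable def breg {E : Type*} [NormedAddCommGroup E] [InnerProductSpace ℝ E]
    (f : E → ℝ) (gf : E → E) (x y : E) : ℝ :=
  f y - f x - ⟪gf x, y - x⟫

section Helpers

variable {E : Type*} [NormedAddCommGroup E] [InnerProductSpace ℝ E]

theorem breg_sub (f g : E → ℝ) (gf gg : E → E) (x y : E) :
    breg (f - g) (gf - gg) x y = breg f gf x y - breg g gg x y := by
  simp only [breg, Pi.sub_apply, inner_sub_left]
  ring

variable [CompleteSpace E]

theorem ContDiff.differentiable_gradient {f : E → ℝ} (hf : ContDiff ℝ 2 f) :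
    Differentiable ℝ (gradient f) :=
  (InnerProductSpace.toDual ℝ E).symm.toContinuousLinearEquiv.differentiable.comp
    ((hf.fderiv_right (m := 1) (by norm_num)).differentiable (by norm_num))

/-- Two-sided quadratic bound on the Bregman divergence of a function with Lipschitz gradient. -/
theorem abs_breg_le_of_lipschitz_gradient {f : E → ℝ} {gf : E → E} {C : ℝ}
    (hf : ∀ z, HasGradientAt f (gf z) z) (hgf : ∀ x y, ‖gf y - gf x‖ ≤ C * ‖y - x‖) (x y : E) :
    |breg f gf x y| ≤ C / 2 * ‖y - x‖ ^ 2 := by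
  have hline (t : ℝ) : HasDerivAt (fun t : ℝ => x + t • (y - x)) (y - x) t := by
    simpa using ((hasDerivAt_id t).smul_const (y - x)).const_add x
  have hderiv (t : ℝ) : HasDerivAt (fun t : ℝ => breg f gf x (x + t • (y - x)))
      ⟪gf (x + t • (y - x)) - gf x, y - x⟫ t := by
    have h₁ := (hf (x + t • (y - x))).hasFDerivAt.comp_hasDerivAt t (hline t)
    have h₂ := (h₁.sub_const (f x)).sub ((hasDerivAt_id t).mul_const ⟪gf x, y - x⟫)
    refine (h₂.congr_deriv ?_).congr_of_eventuallyEq (.of_forall fun s => ?_)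
    · simp [inner_sub_left]
    · simp [breg, inner_smul_right]
  have hquad (t : ℝ) : HasDerivAt (fun t : ℝ => C / 2 * ‖y - x‖ ^ 2 * t ^ 2)
      (C * ‖y - x‖ ^ 2 * t) t := by
    refine ((hasDerivAt_pow 2 t).const_mul (C / 2 * ‖y - x‖ ^ 2)).congr_deriv ?_
    push_cast
    ring
  have key := image_norm_le_of_norm_deriv_right_le_deriv_boundary (a := 0) (b := 1)
    (fun t _ => (hderiv t).continuousAt.continuousWithinAt)
    (fun t _ => (hderiv t).hasDerivWithinAt) (by simp [breg]) hquad
    (fun t ht => by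
      calc ‖⟪gf (x + t • (y - x)) - gf x, y - x⟫‖
          ≤ ‖gf (x + t • (y - x)) - gf x‖ * ‖y - x‖ := norm_inner_le_norm _ _
        _ ≤ C * ‖x + t • (y - x) - x‖ * ‖y - x‖ := by gcongr; exact hgf _ _
        _ = C * ‖y - x‖ ^ 2 * t := by
          rw [add_sub_cancel_left, norm_smul, Real.norm_of_nonneg ht.1]
          ring)
    (Set.right_mem_Icc.2 zero_le_one)
  simpa using key

theorem HasGradientAt.add_half_mul_norm_sq {f : E → ℝ} {g x : E} (hf : HasGradientAt f g x)
    (c : ℝ) : HasGradientAt (fun z => f z + c / 2 * ‖z‖ ^ 2) (g + c • x) x := by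
  rw [hasGradientAt_iff_hasFDerivAt] at hf ⊢
  refine (hf.add ((hasFDerivAt_id x).norm_sq.const_mul (c / 2))).congr_fderiv ?_
  ext v
  simp
  ring

theorem breg_add_half_mul_norm_sq {f : E → ℝ} (hf : Differentiable ℝ f) (c : ℝ) (x y : E) :
    breg (fun z => f z + c / 2 * ‖z‖ ^ 2) (gradient fun z => f z + c / 2 * ‖z‖ ^ 2) x y =
      breg f (gradient f) x y + c / 2 * ‖y - x‖ ^ 2 := by
  rw [breg, ((hf x).hasGradientAt.add_half_mul_norm_sq c).gradient, breg, norm_sub_sq_real,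
    inner_add_left, real_inner_smul_left, inner_sub_right x y x, real_inner_self_eq_norm_sq,
    real_inner_comm x y]
  ring

end Helpers

theorem stmt1 {E : Type*} [NormedAddCommGroup E] [InnerProductSpace ℝ E] [CompleteSpace E]
    (F F₁ : E → ℝ) (σ μF : ℝ) (hσ : 0 ≤ σ) (hμF : 0 < μF)
    (hF : ContDiff ℝ 2 F) (hF₁ : ContDiff ℝ 2 F₁)
    (hFconv : ConvexOn ℝ Set.univ F) (hF₁conv : ConvexOn ℝ Set.univ F₁)
    (hFstrong : ∀ x y : E, F y ≥ F x + ⟪gradient F x, y - x⟫ + μF / 2 * ‖y - x‖ ^ 2)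
    (hHess : ∀ x : E, ‖fderiv ℝ (gradient F) x - fderiv ℝ (gradient F₁) x‖ ≤ σ)
    (φ : E → ℝ) (hφ : φ = fun x => F₁ x + σ / 2 * ‖x‖ ^ 2) :
    ∀ x y : E,
      μF / (μF + 2 * σ) * breg φ (gradient φ) x y ≤ breg F (gradient F) x y ∧
      breg F (gradient F) x y ≤ breg φ (gradient φ) x y := by
  intro x y
  have dF : Differentiable ℝ F := hF.differentiable (by norm_num)
  have dF₁ : Differentiable ℝ F₁ := hF₁.differentiable (by norm_num)
  have hgrad (z : E) : HasGradientAt (F - F₁) ((gradient F - gradient F₁) z) z := by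
    rw [hasGradientAt_iff_hasFDerivAt, Pi.sub_apply, map_sub]
    exact (dF z).hasGradientAt.hasFDerivAt.sub (dF₁ z).hasGradientAt.hasFDerivAt
  have hlip (u v : E) : ‖(gradient F - gradient F₁) v - (gradient F - gradient F₁) u‖ ≤
      σ * ‖v - u‖ := by
    refine convex_univ.norm_image_sub_le_of_norm_fderiv_le (𝕜 := ℝ)
      (fun z _ => (hF.differentiable_gradient z).sub (hF₁.differentiable_gradient z))
      (fun z _ => ?_) (Set.mem_univ u) (Set.mem_univ v)
    rw [fderiv_sub (hF.differentiable_gradient z) (hF₁.differentiable_gradient z)]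
    exact hHess z
  have hdiff := abs_le.1 (abs_breg_le_of_lipschitz_gradient hgrad hlip x y)
  rw [breg_sub] at hdiff
  have hstrong : μF / 2 * ‖y - x‖ ^ 2 ≤ breg F (gradient F) x y := by
    have := hFstrong x y
    simp only [breg]
    linarith
  rw [hφ, breg_add_half_mul_norm_sq dF₁]
  refine ⟨?_, by linarith [hdiff.2]⟩
  rw [div_mul_eq_mul_div, div_le_iff₀ (by positivity)]
  nlinarith [mul_le_mul_of_nonneg_left hdiff.1 hμF.le, mul_le_mul_of_nonneg_left hstrong hσ]
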